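/- arXiv:2003.04051 — 4 statements merged into one kernel-verified Lean document; each statement's English description precedes it below -/
import Mathlib

section
/- For every nonnegative finite Borel measure μ on ℝ³ and every smooth compactly supported φ : ℝ³ → ℂ, one has ∫_{ℝ³} V_μ(x)²·|φ(x)|² dx ≤ 4·μ(ℝ³)²·∫_{ℝ³} ‖∇φ(x)‖² dx. (This is the Hardy-inequality bound behind the paper's estimate ‖V_μ·(D₀)⁻¹‖ ≤ 2μ(ℝ³).) -/
open MeasureTheory Real

/-- The Coulomb potential generated by a measure `μ` on `ℝ³`, with values in
`[0,+∞]`. -/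
noncomputable def coulombE (μ : Measure (EuclideanSpace ℝ (Fin 3)))
    (x : EuclideanSpace ℝ (Fin 3)) : ENNReal :=
  ∫⁻ y, ENNReal.ofReal ‖x - y‖⁻¹ ∂μ

/-- `‖∇φ(x)‖² = ∑ⱼ |∂ⱼφ(x)|²` for `φ : ℝ³ → ℂ`. -/
noncomputable def gradSq (φ : EuclideanSpace ℝ (Fin 3) → ℂ)
    (x : EuclideanSpace ℝ (Fin 3)) : ℝ :=
  ∑ j : Fin 3, ‖fderiv ℝ φ x (EuclideanSpace.single j 1)‖ ^ 2

/-- The integral of a directional derivative of a compactly supported `C¹` function vanishes. -/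
theorem integral_fderiv_apply_eq_zero_of_hasCompactSupport
    {E : Type*} [NormedAddCommGroup E] [NormedSpace ℝ E] [MeasurableSpace E] [BorelSpace E]
    [FiniteDimensional ℝ E] (ν : Measure E) [ν.IsAddHaarMeasure]
    {g : E → ℝ} (hg : ContDiff ℝ 1 g) (hc : HasCompactSupport g) (v : E) :
    Integrable (fun x => fderiv ℝ g x v) ν ∧ ∫ x, fderiv ℝ g x v ∂ν = 0 := by
  have hi : Integrable (fun x => fderiv ℝ g x v) ν :=
    ((hg.continuous_fderiv one_ne_zero).clm_apply continuous_const).integrable_of_hasCompactSupport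
      (hc.fderiv_apply ℝ v)
  refine ⟨hi, ?_⟩
  have h := integral_mul_fderiv_eq_neg_fderiv_mul_of_integrable (μ := ν) (𝕜 := ℝ)
    (f := fun _ : E => (1 : ℝ)) (g := g) (v := v) (by simp) (by simpa using hi)
    (by simpa using hg.continuous.integrable_of_hasCompactSupport hc)
    (fun x _ => differentiableAt_const _) (fun x _ => (hg.differentiable one_ne_zero) x)
  simpa using h

/-- The directional derivative along `eⱼ` of `x ↦ (xⱼ - aⱼ) (‖x - a‖² + ε)⁻¹ ‖φ x‖²`. -/
theorem fderiv_regularized_field_mul_normSq {ι : Type*} [Fintype ι] [DecidableEq ι]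
    {φ : EuclideanSpace ℝ ι → ℂ} {x : EuclideanSpace ℝ ι} (hφ : DifferentiableAt ℝ φ x)
    (a : EuclideanSpace ℝ ι) {ε : ℝ} (hε : 0 < ε) (j : ι) :
    fderiv ℝ (fun x => (x j - a j) * (‖x - a‖ ^ 2 + ε)⁻¹ * ‖φ x‖ ^ 2) x
        (EuclideanSpace.single j 1) =
      ((‖x - a‖ ^ 2 + ε)⁻¹ - 2 * (x j - a j) ^ 2 * (‖x - a‖ ^ 2 + ε)⁻¹ ^ 2) * ‖φ x‖ ^ 2 +
        2 * ((x j - a j) * (‖x - a‖ ^ 2 + ε)⁻¹) *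
          inner ℝ (φ x) (fderiv ℝ φ x (EuclideanSpace.single j 1)) := by
  have hpos : ‖x - a‖ ^ 2 + ε ≠ 0 := by positivity
  have h1 : HasFDerivAt (fun x : EuclideanSpace ℝ ι => x j - a j)
      (EuclideanSpace.proj j : EuclideanSpace ℝ ι →L[ℝ] ℝ) x :=
    (EuclideanSpace.proj j : EuclideanSpace ℝ ι →L[ℝ] ℝ).hasFDerivAt.sub_const (a j)
  have h2 := (((hasFDerivAt_id (𝕜 := ℝ) x).sub_const a).norm_sq).add_const ε
  have h3 := (hasDerivAt_inv hpos).comp_hasFDerivAt x h2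
  have h4 := hφ.hasFDerivAt.norm_sq
  have h := (h1.mul h3).mul h4
  have := congrArg (fun L => L (EuclideanSpace.single j 1)) h.fderiv
  refine Eq.trans this ?_
  simp [EuclideanSpace.inner_single_right]
  field_simp
  ring

/-- The pointwise inequality behind Hardy's inequality, obtained by completing squares. -/
theorem regularized_hardy_pointwise (z : Fin 3 → ℝ) (w : ℂ) (v : Fin 3 → ℂ) {ε : ℝ}
    (hε : 0 < ε) {s : ℝ} (hs : s = ∑ j, z j ^ 2) :
    (s + ε)⁻¹ * ‖w‖ ^ 2 ≤ 4 * ∑ j, ‖v j‖ ^ 2 +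
      2 * ∑ j, (((s + ε)⁻¹ - 2 * z j ^ 2 * (s + ε)⁻¹ ^ 2) * ‖w‖ ^ 2 +
        2 * (z j * (s + ε)⁻¹) * inner ℝ w (v j)) := by
  have hs0 : 0 ≤ s := hs ▸ Finset.sum_nonneg fun j _ => sq_nonneg _
  set q := (s + ε)⁻¹ with hq
  have hq0 : 0 < q := by positivity
  have hqs : (s + ε) * q = 1 := mul_inv_cancel₀ (by positivity)
  have hsq (j : Fin 3) : 0 ≤ ‖v j‖ ^ 2 + z j * q * inner ℝ w (v j) +
      z j ^ 2 * q ^ 2 / 4 * ‖w‖ ^ 2 := by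
    have h := norm_add_sq_real (v j) ((z j * q / 2) • w)
    rw [norm_smul, inner_smul_right, mul_pow, Real.norm_eq_abs, sq_abs,
      real_inner_comm] at h
    nlinarith [sq_nonneg ‖v j + (z j * q / 2) • w‖]
  have h0 := hsq 0
  have h1 := hsq 1
  have h2 := hsq 2
  simp only [Fin.sum_univ_three] at hs ⊢
  have hsum : s * q ^ 2 * ‖w‖ ^ 2 =
      (z 0 ^ 2 * q ^ 2 + z 1 ^ 2 * q ^ 2 + z 2 ^ 2 * q ^ 2) * ‖w‖ ^ 2 := by rw [hs]; ring
  have hgap : 0 ≤ q * ‖w‖ ^ 2 - s * q ^ 2 * ‖w‖ ^ 2 := by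
    have : q * ‖w‖ ^ 2 - s * q ^ 2 * ‖w‖ ^ 2 = ε * q ^ 2 * ‖w‖ ^ 2 := by
      linear_combination (-q * ‖w‖ ^ 2) * hqs
    rw [this]; positivity
  nlinarith

/-- Hardy's inequality on `ℝ³` with the regularized weight `(‖x - a‖² + ε)⁻¹`. -/
theorem lintegral_regularized_hardy {φ : EuclideanSpace ℝ (Fin 3) → ℂ} (hφ : ContDiff ℝ 1 φ)
    (hsupp : HasCompactSupport φ) (a : EuclideanSpace ℝ (Fin 3)) {ε : ℝ} (hε : 0 < ε) :
    ∫⁻ x, ENNReal.ofReal ((‖x - a‖ ^ 2 + ε)⁻¹ * ‖φ x‖ ^ 2) ≤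
      4 * ∫⁻ x, ENNReal.ofReal (gradSq φ x) := by
  let G (j : Fin 3) (x : EuclideanSpace ℝ (Fin 3)) : ℝ :=
    (x j - a j) * (‖x - a‖ ^ 2 + ε)⁻¹ * ‖φ x‖ ^ 2
  have hweight : ContDiff ℝ 1 fun x : EuclideanSpace ℝ (Fin 3) => (‖x - a‖ ^ 2 + ε)⁻¹ :=
    (((contDiff_id.sub contDiff_const).norm_sq ℝ).add contDiff_const).inv
      fun x => by positivity
  have hG (j : Fin 3) : ContDiff ℝ 1 (G j) :=
    (((contDiff_euclidean.1 contDiff_id j).sub contDiff_const).mul hweight).mul (hφ.norm_sq ℝ)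
  have hnorm : HasCompactSupport fun x => ‖φ x‖ ^ 2 :=
    hsupp.comp_left (g := fun w : ℂ => ‖w‖ ^ 2) (by simp)
  have hGi (j : Fin 3) := integral_fderiv_apply_eq_zero_of_hasCompactSupport volume (hG j)
    (hnorm.mul_left) (EuclideanSpace.single j 1)
  have hgrad : Integrable (gradSq φ) := by
    refine integrable_finsetSum _ fun j _ => ?_
    refine Continuous.integrable_of_hasCompactSupport
      (((hφ.continuous_fderiv one_ne_zero).clm_apply continuous_const).norm.pow 2) ?_
    exact (hsupp.fderiv_apply ℝ (EuclideanSpace.single j 1)).comp_left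
      (g := fun w : ℂ => ‖w‖ ^ 2) (by simp)
  have hleft : Integrable fun x => (‖x - a‖ ^ 2 + ε)⁻¹ * ‖φ x‖ ^ 2 :=
    (hweight.continuous.mul (hφ.continuous.norm.pow 2)).integrable_of_hasCompactSupport
      hnorm.mul_left
  have hsum : Integrable fun x => ∑ j, fderiv ℝ (G j) x (EuclideanSpace.single j 1) :=
    integrable_finsetSum _ fun j _ => (hGi j).1
  have hle : ∫ x, (‖x - a‖ ^ 2 + ε)⁻¹ * ‖φ x‖ ^ 2 ≤ 4 * ∫ x, gradSq φ x := by
    calc ∫ x, (‖x - a‖ ^ 2 + ε)⁻¹ * ‖φ x‖ ^ 2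
        ≤ ∫ x, (4 * gradSq φ x +
            2 * ∑ j, fderiv ℝ (G j) x (EuclideanSpace.single j 1)) := by
          refine integral_mono hleft ((hgrad.const_mul 4).add (hsum.const_mul 2)) fun x => ?_
          simp only [G, fderiv_regularized_field_mul_normSq
            ((hφ.differentiable one_ne_zero) x) a hε]
          exact regularized_hardy_pointwise (fun j => x j - a j) (φ x)
            (fun j => fderiv ℝ φ x (EuclideanSpace.single j 1)) hε
            (by simp [EuclideanSpace.norm_sq_eq])
      _ = 4 * ∫ x, gradSq φ x := by
          rw [integral_add (hgrad.const_mul 4) (hsum.const_mul 2), integral_const_mul,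
            integral_const_mul, integral_finsetSum _ fun j _ => (hGi j).1,
            Finset.sum_eq_zero fun j _ => (hGi j).2]
          simp
  have hgrad0 : ∀ x, 0 ≤ gradSq φ x := fun x => Finset.sum_nonneg fun j _ => sq_nonneg _
  rw [← ofReal_integral_eq_lintegral_ofReal hleft (.of_forall fun x => by positivity),
    ← ofReal_integral_eq_lintegral_ofReal hgrad (.of_forall hgrad0)]
  refine (ENNReal.ofReal_le_ofReal hle).trans_eq ?_
  rw [ENNReal.ofReal_mul (by norm_num)]
  norm_num

/-- Hardy's inequality on `ℝ³`. -/
theorem lintegral_hardy {φ : EuclideanSpace ℝ (Fin 3) → ℂ} (hφ : ContDiff ℝ 1 φ)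
    (hsupp : HasCompactSupport φ) (a : EuclideanSpace ℝ (Fin 3)) :
    ∫⁻ x, ENNReal.ofReal ‖x - a‖⁻¹ ^ 2 * ENNReal.ofReal (‖φ x‖ ^ 2) ≤
      4 * ∫⁻ x, ENNReal.ofReal (gradSq φ x) := by
  have hcont := hφ.continuous
  let F (n : ℕ) (x : EuclideanSpace ℝ (Fin 3)) : ENNReal :=
    ENNReal.ofReal ((‖x - a‖ ^ 2 + 1 / ((n : ℝ) + 1))⁻¹ * ‖φ x‖ ^ 2)
  have hF (n : ℕ) : Measurable (F n) := by
    have h := hcont.measurable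
    fun_prop
  have hlim (x : EuclideanSpace ℝ (Fin 3)) :
      ENNReal.ofReal ‖x - a‖⁻¹ ^ 2 * ENNReal.ofReal (‖φ x‖ ^ 2) ≤
        Filter.liminf (fun n => F n x) Filter.atTop := by
    rcases eq_or_ne x a with rfl | hx
    · simp
    have hne : ‖x - a‖ ^ 2 + 0 ≠ 0 := by
      simpa [sub_eq_zero] using hx
    have ht : Filter.Tendsto (fun n => F n x) Filter.atTop
        (nhds (ENNReal.ofReal ((‖x - a‖ ^ 2 + 0)⁻¹ * ‖φ x‖ ^ 2))) :=
      ENNReal.tendsto_ofReal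
        (((tendsto_const_nhds.add tendsto_one_div_add_atTop_nhds_zero_nat).inv₀ hne).mul_const _)
    rw [ht.liminf_eq, ← ENNReal.ofReal_pow (by positivity), ← ENNReal.ofReal_mul (by positivity)]
    simp
  calc ∫⁻ x, ENNReal.ofReal ‖x - a‖⁻¹ ^ 2 * ENNReal.ofReal (‖φ x‖ ^ 2)
      ≤ ∫⁻ x, Filter.liminf (fun n => F n x) Filter.atTop := lintegral_mono hlim
    _ ≤ Filter.liminf (fun n => ∫⁻ x, F n x) Filter.atTop := lintegral_liminf_le hF
    _ ≤ 4 * ∫⁻ x, ENNReal.ofReal (gradSq φ x) := by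
        refine Filter.liminf_le_of_le (by isBoundedDefault) fun b hb => ?_
        obtain ⟨n, hn⟩ := hb.exists
        exact hn.trans (lintegral_regularized_hardy hφ hsupp a (by positivity))

/-- Cauchy-Schwarz against the constant function `1`. -/
theorem sq_lintegral_le_measure_univ_mul_lintegral_sq {α : Type*} [MeasurableSpace α]
    (μ : Measure α) {f : α → ENNReal} (hf : AEMeasurable f μ) :
    (∫⁻ y, f y ∂μ) ^ 2 ≤ μ Set.univ * ∫⁻ y, f y ^ 2 ∂μ := by
  have h := ENNReal.lintegral_mul_le_Lp_mul_Lq μ Real.HolderConjugate.two_two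
    (aemeasurable_const (b := (1 : ENNReal))) hf
  have h2 := pow_le_pow_left' h 2
  rw [mul_pow, ← ENNReal.rpow_natCast (_ ^ (_ : ℝ)), ← ENNReal.rpow_natCast (_ ^ (_ : ℝ)),
    ← ENNReal.rpow_mul, ← ENNReal.rpow_mul] at h2
  simpa using h2

theorem hardy_bound_coulomb_squared
    (μ : Measure (EuclideanSpace ℝ (Fin 3))) [IsFiniteMeasure μ]
    (φ : EuclideanSpace ℝ (Fin 3) → ℂ)
    (hφ : ContDiff ℝ (⊤ : ℕ∞) φ) (hsupp : HasCompactSupport φ) :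
    ∫⁻ x, coulombE μ x ^ 2 * ENNReal.ofReal (‖φ x‖ ^ 2) ≤
      ENNReal.ofReal (4 * (μ Set.univ).toReal ^ 2) *
        ∫⁻ x, ENNReal.ofReal (gradSq φ x) := by
  have hφ1 : ContDiff ℝ 1 φ := hφ.of_le (by exact_mod_cast le_top)
  have hmφ := hφ1.continuous.measurable
  have hconst : ENNReal.ofReal (4 * (μ Set.univ).toReal ^ 2) = μ Set.univ * (4 * μ Set.univ) := by
    rw [ENNReal.ofReal_mul (by norm_num), ENNReal.ofReal_pow (by positivity),
      ENNReal.ofReal_toReal (measure_ne_top μ _)]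
    norm_num
    ring
  have hmeas : Measurable fun p : EuclideanSpace ℝ (Fin 3) × EuclideanSpace ℝ (Fin 3) =>
      ENNReal.ofReal ‖p.1 - p.2‖⁻¹ ^ 2 * ENNReal.ofReal (‖φ p.1‖ ^ 2) := by fun_prop
  calc ∫⁻ x, coulombE μ x ^ 2 * ENNReal.ofReal (‖φ x‖ ^ 2)
      ≤ ∫⁻ x, μ Set.univ *
          ∫⁻ y, ENNReal.ofReal ‖x - y‖⁻¹ ^ 2 * ENNReal.ofReal (‖φ x‖ ^ 2) ∂μ := by
        refine lintegral_mono fun x => ?_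
        rw [lintegral_mul_const _ (by fun_prop), ← mul_assoc]
        gcongr
        exact sq_lintegral_le_measure_univ_mul_lintegral_sq μ
          (Measurable.aemeasurable (by fun_prop))
    _ = μ Set.univ *
          ∫⁻ y, (∫⁻ x, ENNReal.ofReal ‖x - y‖⁻¹ ^ 2 * ENNReal.ofReal (‖φ x‖ ^ 2)) ∂μ := by
        rw [lintegral_const_mul' _ _ (measure_ne_top μ _),
          lintegral_lintegral_swap hmeas.aemeasurable]
    _ ≤ μ Set.univ * ∫⁻ _, (4 * ∫⁻ x, ENNReal.ofReal (gradSq φ x)) ∂μ := by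
        gcongr with y
        exact lintegral_hardy hφ1 hsupp y
    _ = _ := by
        rw [lintegral_const, hconst]
        ring
end

section
/- There exists a universal constant C > 0 such that the following holds. Let U : ℝ³ → ℝ be twice continuously differentiable with U ≥ 0 and ΔU ≥ 0 everywhere, and set K := {x ∈ ℝ³ : U(x) = 0}. Then for every x₀ ∈ ℝ³ and every r > 0: ∫_{B_r(x₀)} ( U²/r² + ‖∇U‖² ) dx ≤ C·( vol(B_{2r}(x₀)∖K) / vol(B_r(x₀)) )^{2/3} · ∫_{B_{2r}(x₀)} ( U²/(4r²) + ‖∇U‖² ) dx. -/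
open MeasureTheory Real

/-- `‖∇U(x)‖² = ∑ⱼ (∂ⱼU(x))²` for `U : ℝ³ → ℝ`. -/
noncomputable def gradNormSq (U : EuclideanSpace ℝ (Fin 3) → ℝ)
    (x : EuclideanSpace ℝ (Fin 3)) : ℝ :=
  ∑ j : Fin 3, (fderiv ℝ U x (EuclideanSpace.single j 1)) ^ 2

/-- The Laplacian `ΔU(x) = ∑ⱼ ∂ⱼ∂ⱼU(x)` of `U : ℝ³ → ℝ`. -/
noncomputable def laplacian (U : EuclideanSpace ℝ (Fin 3) → ℝ)
    (x : EuclideanSpace ℝ (Fin 3)) : ℝ :=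
  ∑ j : Fin 3,
    fderiv ℝ (fun y => fderiv ℝ U y (EuclideanSpace.single j 1)) x
      (EuclideanSpace.single j 1)

lemma gradNormSq_nonneg (U : EuclideanSpace ℝ (Fin 3) → ℝ) (x : EuclideanSpace ℝ (Fin 3)) :
    0 ≤ gradNormSq U x :=
  Finset.sum_nonneg fun _ _ => sq_nonneg _

lemma continuous_fderiv_single {U : EuclideanSpace ℝ (Fin 3) → ℝ} (hU : ContDiff ℝ 1 U)
    (j : Fin 3) : Continuous fun x => fderiv ℝ U x (EuclideanSpace.single j 1) :=
  (hU.continuous_fderiv one_ne_zero).clm_apply continuous_const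

lemma continuous_gradNormSq {U : EuclideanSpace ℝ (Fin 3) → ℝ} (hU : ContDiff ℝ 1 U) :
    Continuous (gradNormSq U) :=
  continuous_finsetSum _ fun j _ => (continuous_fderiv_single hU j).pow 2

lemma gradNormSq_eq_zero_of_notMem_tsupport {U : EuclideanSpace ℝ (Fin 3) → ℝ}
    {x : EuclideanSpace ℝ (Fin 3)} (hx : x ∉ tsupport U) : gradNormSq U x = 0 := by
  have : fderiv ℝ U x = 0 := by
    by_contra h
    exact hx (support_fderiv_subset ℝ h)
  simp [gradNormSq, this]

lemma hasCompactSupport_gradNormSq {U : EuclideanSpace ℝ (Fin 3) → ℝ}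
    (hU : HasCompactSupport U) : HasCompactSupport (gradNormSq U) :=
  HasCompactSupport.intro hU fun _ hx => gradNormSq_eq_zero_of_notMem_tsupport hx

lemma sq_norm_fderiv_le_gradNormSq (U : EuclideanSpace ℝ (Fin 3) → ℝ)
    (x : EuclideanSpace ℝ (Fin 3)) : ‖fderiv ℝ U x‖ ^ 2 ≤ gradNormSq U x := by
  have h : ‖fderiv ℝ U x‖ ≤ √(gradNormSq U x) := by
    refine ContinuousLinearMap.opNorm_le_bound _ (sqrt_nonneg _) fun v => ?_
    have hv : v = ∑ j : Fin 3, v j • EuclideanSpace.single j (1 : ℝ) := by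
      ext i
      fin_cases i <;> simp [Fin.sum_univ_three]
    have hL : fderiv ℝ U x v =
        ∑ j : Fin 3, fderiv ℝ U x (EuclideanSpace.single j 1) * v j := by
      conv_lhs => rw [hv]
      simp [mul_comm]
    rw [hL, EuclideanSpace.norm_eq, ← sqrt_mul (gradNormSq_nonneg U x), Real.norm_eq_abs]
    apply abs_le_sqrt
    simpa [gradNormSq] using Finset.sum_mul_sq_le_sq_mul_sq Finset.univ
      (fun j : Fin 3 => fderiv ℝ U x (EuclideanSpace.single j 1)) (fun j => v j)
  calc ‖fderiv ℝ U x‖ ^ 2 ≤ √(gradNormSq U x) ^ 2 := by gcongr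
    _ = gradNormSq U x := sq_sqrt (gradNormSq_nonneg U x)

lemma gradNormSq_mul_le {f g : EuclideanSpace ℝ (Fin 3) → ℝ} (hf : ContDiff ℝ 1 f)
    (hg : ContDiff ℝ 1 g) (x : EuclideanSpace ℝ (Fin 3)) :
    gradNormSq (fun y => f y * g y) x ≤
      2 * (f x ^ 2 * gradNormSq g x + g x ^ 2 * gradNormSq f x) := by
  simp only [gradNormSq, Finset.mul_sum, ← Finset.sum_add_distrib]
  refine Finset.sum_le_sum fun j _ => ?_
  rw [fderiv_fun_mul (hf.differentiable one_ne_zero x) (hg.differentiable one_ne_zero x)]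
  simp only [add_apply, smul_apply, smul_eq_mul]
  nlinarith [sq_nonneg (f x * fderiv ℝ g x (EuclideanSpace.single j 1) -
    g x * fderiv ℝ f x (EuclideanSpace.single j 1))]

/-- Smooth cutoff functions between concentric balls, with the scale-invariant gradient bound. -/
lemma exists_cutoff {a b : ℝ} (ha : 0 < a) (hab : a < b) :
    ∃ M : ℝ, 0 ≤ M ∧ ∀ (x₀ : EuclideanSpace ℝ (Fin 3)) (r : ℝ), 0 < r →
      ∃ η : EuclideanSpace ℝ (Fin 3) → ℝ, ContDiff ℝ 1 η ∧ (∀ x, 0 ≤ η x) ∧ (∀ x, η x ≤ 1) ∧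
        (∀ x ∈ Metric.closedBall x₀ (a * r), η x = 1) ∧
        tsupport η ⊆ Metric.closedBall x₀ (b * r) ∧
        ∀ x, gradNormSq η x ≤ M / r ^ 2 := by
  let f : ContDiffBump (0 : EuclideanSpace ℝ (Fin 3)) := ⟨a, b, ha, hab⟩
  have hf : ContDiff ℝ 1 f := f.contDiff
  obtain ⟨M, hM⟩ := (hasCompactSupport_gradNormSq f.hasCompactSupport).exists_bound_of_continuous
    (continuous_gradNormSq hf)
  refine ⟨M, (norm_nonneg _).trans (hM 0), fun x₀ r hr => ?_⟩
  have hd (x : EuclideanSpace ℝ (Fin 3)) :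
      dist (r⁻¹ • (x - x₀)) 0 = r⁻¹ * dist x x₀ := by
    rw [dist_zero_right, norm_smul, dist_eq_norm, Real.norm_of_nonneg (inv_nonneg.2 hr.le)]
  refine ⟨fun x => f (r⁻¹ • (x - x₀)), ?_, fun x => f.nonneg, fun x => f.le_one, fun x hx => ?_,
    ?_, fun x => ?_⟩
  · exact f.contDiff.comp ((contDiff_id.sub contDiff_const).const_smul r⁻¹)
  · apply f.one_of_mem_closedBall
    rw [Metric.mem_closedBall, hd, inv_mul_le_iff₀ hr, mul_comm]
    exact hx
  · refine closure_minimal (fun x hx => ?_) Metric.isClosed_closedBall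
    rw [Metric.mem_closedBall]
    by_contra! h
    refine hx (f.zero_of_le_dist ?_)
    rw [hd, le_inv_mul_iff₀ hr, mul_comm]
    exact h.le
  · have hder : HasFDerivAt (fun x => f (r⁻¹ • (x - x₀)))
        ((fderiv ℝ f (r⁻¹ • (x - x₀))).comp
          (r⁻¹ • ContinuousLinearMap.id ℝ (EuclideanSpace ℝ (Fin 3)))) x :=
      (hf.differentiable one_ne_zero _).hasFDerivAt.comp x
        (((hasFDerivAt_id x).sub_const x₀).const_smul r⁻¹)
    have : gradNormSq (fun x => f (r⁻¹ • (x - x₀))) x =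
        gradNormSq f (r⁻¹ • (x - x₀)) / r ^ 2 := by
      simp only [gradNormSq, hder.fderiv, Finset.sum_div]
      refine Finset.sum_congr rfl fun j _ => ?_
      simp only [ContinuousLinearMap.comp_apply, smul_apply,
        ContinuousLinearMap.id_apply, map_smul, smul_eq_mul]
      field_simp
    rw [this]
    gcongr
    exact (le_abs_self _).trans (hM _)

/-- The Caccioppoli inequality for nonnegative subharmonic functions. -/
lemma caccioppoli {U η : EuclideanSpace ℝ (Fin 3) → ℝ} (hU : ContDiff ℝ 2 U)
    (hU0 : ∀ x, 0 ≤ U x) (hΔ : ∀ x, 0 ≤ laplacian U x) (hη : ContDiff ℝ 1 η)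
    (hηc : HasCompactSupport η) :
    ∫ x, η x ^ 2 * gradNormSq U x ≤ 4 * ∫ x, U x ^ 2 * gradNormSq η x := by
  have hU1 : ContDiff ℝ 1 U := hU.of_le one_le_two
  have hdU (j : Fin 3) :
      ContDiff ℝ 1 fun x => fderiv ℝ U x (EuclideanSpace.single j 1) :=
    (hU.fderiv_right (m := 1) (by norm_num)).clm_apply contDiff_const
  have hη2 : HasCompactSupport fun x => η x ^ 2 := by
    simpa [Function.comp_def] using hηc.comp_left (g := fun t : ℝ => t ^ 2) (by simp)
  have hw : ContDiff ℝ 1 fun x => η x ^ 2 * U x := (hη.pow 2).mul hU1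
  have hwc : HasCompactSupport fun x => η x ^ 2 * U x := hη2.mul_right
  have hint (j : Fin 3) : Integrable fun x => fderiv ℝ (fun y => η y ^ 2 * U y) x
      (EuclideanSpace.single j 1) * fderiv ℝ U x (EuclideanSpace.single j 1) := by
    refine ((continuous_fderiv_single hw j).mul
      (continuous_fderiv_single hU1 j)).integrable_of_hasCompactSupport ?_
    exact (hwc.fderiv_apply ℝ _).mul_right
  have hint' (j : Fin 3) : Integrable fun x => (η x ^ 2 * U x) *
      fderiv ℝ (fun y => fderiv ℝ U y (EuclideanSpace.single j 1)) x
        (EuclideanSpace.single j 1) :=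
    (hw.continuous.mul (continuous_fderiv_single (hdU j) j)).integrable_of_hasCompactSupport
      hwc.mul_right
  have hparts (j : Fin 3) := integral_mul_fderiv_eq_neg_fderiv_mul_of_integrable
    (hint j) (hint' j)
    ((hw.continuous.mul (hdU j).continuous).integrable_of_hasCompactSupport hwc.mul_right)
    (fun x _ => hw.differentiable one_ne_zero x)
    (fun x _ => (hdU j).differentiable one_ne_zero x)
  have hΔint : 0 ≤ ∫ x, (η x ^ 2 * U x) * laplacian U x :=
    integral_nonneg fun x => mul_nonneg (mul_nonneg (sq_nonneg _) (hU0 x)) (hΔ x)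
  have hsum : ∫ x, ∑ j : Fin 3, fderiv ℝ (fun y => η y ^ 2 * U y) x
      (EuclideanSpace.single j 1) * fderiv ℝ U x (EuclideanSpace.single j 1) ≤ 0 := by
    simp only [laplacian, Finset.mul_sum] at hΔint
    rw [integral_finsetSum _ fun j _ => hint' j, Finset.sum_congr rfl fun j _ => hparts j,
      Finset.sum_neg_distrib, ← integral_finsetSum _ fun j _ => hint j] at hΔint
    linarith
  have hi1 : Integrable fun x => η x ^ 2 * gradNormSq U x :=
    ((hη.continuous.pow 2).mul (continuous_gradNormSq hU1)).integrable_of_hasCompactSupport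
      hη2.mul_right
  have hi2 : Integrable fun x => U x ^ 2 * gradNormSq η x :=
    ((hU.continuous.pow 2).mul (continuous_gradNormSq hη)).integrable_of_hasCompactSupport
      (hasCompactSupport_gradNormSq hηc).mul_left
  have hpt : ∫ x, ((1 / 2) * (η x ^ 2 * gradNormSq U x) - 2 * (U x ^ 2 * gradNormSq η x)) ≤
      ∫ x, ∑ j : Fin 3, fderiv ℝ (fun y => η y ^ 2 * U y) x
      (EuclideanSpace.single j 1) * fderiv ℝ U x (EuclideanSpace.single j 1) := by
    refine integral_mono ((hi1.const_mul _).sub (hi2.const_mul _))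
      (integrable_finsetSum _ fun j _ => hint j) fun x => ?_
    simp only [gradNormSq, Finset.mul_sum, ← Finset.sum_sub_distrib]
    refine Finset.sum_le_sum fun j _ => ?_
    have hder := (((hη.differentiable one_ne_zero x).hasFDerivAt.pow 2).mul
      (hU1.differentiable one_ne_zero x).hasFDerivAt).fderiv
    simp only [Pi.mul_def] at hder
    rw [hder]
    simp only [add_apply, smul_apply, smul_eq_mul]
    norm_num
    nlinarith [sq_nonneg (η x * fderiv ℝ U x (EuclideanSpace.single j 1) +
      2 * (U x * fderiv ℝ η x (EuclideanSpace.single j 1)))]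
  rw [integral_sub (hi1.const_mul _) (hi2.const_mul _), integral_const_mul,
    integral_const_mul] at hpt
  linarith

lemma MeasureTheory.MemLp.eLpNorm_two_eq_ofReal_sqrt {α F : Type*} [MeasurableSpace α]
    {μ : Measure α} [NormedAddCommGroup F] {f : α → F} (hf : MemLp f 2 μ) :
    eLpNorm f 2 μ = ENNReal.ofReal √(∫ x, ‖f x‖ ^ 2 ∂μ) := by
  rw [hf.eLpNorm_eq_integral_rpow_norm two_ne_zero ENNReal.ofNat_ne_top, sqrt_eq_rpow]
  simp

/-- A Faber–Krahn type inequality: the Sobolev inequality combined with Hölder's inequality on a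
set containing the support. -/
lemma exists_integral_sq_le_rpow_volume_mul :
    ∃ S : ℝ, 0 ≤ S ∧ ∀ (V : EuclideanSpace ℝ (Fin 3) → ℝ), ContDiff ℝ 1 V →
      HasCompactSupport V → ∀ s : Set (EuclideanSpace ℝ (Fin 3)), Function.support V ⊆ s →
      volume s ≠ ⊤ →
      ∫ x, V x ^ 2 ≤ S * (volume s).toReal ^ ((2 : ℝ) / 3) * ∫ x, gradNormSq V x := by
  set c : NNReal := eLpNormLESNormFDerivOfEqInnerConst
    (volume : Measure (EuclideanSpace ℝ (Fin 3))) ((2 : NNReal) : ℝ)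
  refine ⟨(c : ℝ) ^ 2, sq_nonneg _, fun V hV hVc s hs hsfin => ?_⟩
  have hsob := eLpNorm_le_eLpNorm_fderiv_of_eq_inner volume hV hVc (p := 2) (p' := 6)
    one_le_two (by simp) (by simp; norm_num)
  have hhol : eLpNorm V 2 volume ≤ eLpNorm V 6 volume * volume s ^ ((1 : ℝ) / 3) := by
    have h := eLpNorm_le_eLpNorm_mul_rpow_measure_univ (μ := volume.restrict s)
      (p := 2) (q := 6) (by norm_num) hV.continuous.aestronglyMeasurable
    rw [eLpNorm_restrict_eq_of_support_subset hs, eLpNorm_restrict_eq_of_support_subset hs,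
      Measure.restrict_apply_univ] at h
    convert h using 3
    norm_num
  have hmV : MemLp V 2 volume := hV.continuous.memLp_of_hasCompactSupport hVc
  have hmD : MemLp (fderiv ℝ V) 2 volume :=
    (hV.continuous_fderiv one_ne_zero).memLp_of_hasCompactSupport (hVc.fderiv ℝ)
  have hchain : eLpNorm V 2 volume ≤
      c * eLpNorm (fderiv ℝ V) 2 volume * volume s ^ ((1 : ℝ) / 3) :=
    hhol.trans (by gcongr; exact_mod_cast hsob)
  have hD : ∫ x, ‖fderiv ℝ V x‖ ^ 2 ≤ ∫ x, gradNormSq V x := by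
    refine integral_mono (hmD.integrable_norm_pow two_ne_zero) ?_ (sq_norm_fderiv_le_gradNormSq V)
    exact (continuous_gradNormSq hV).integrable_of_hasCompactSupport
      (hasCompactSupport_gradNormSq hVc)
  rw [hmV.eLpNorm_two_eq_ofReal_sqrt, hmD.eLpNorm_two_eq_ofReal_sqrt] at hchain
  have hreal := ENNReal.toReal_mono (by finiteness) hchain
  rw [ENNReal.toReal_ofReal (sqrt_nonneg _), ENNReal.toReal_mul, ENNReal.toReal_mul,
    ENNReal.toReal_ofReal (sqrt_nonneg _), ← ENNReal.toReal_rpow, ENNReal.coe_toReal] at hreal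
  have hsq := pow_le_pow_left₀ (sqrt_nonneg _) hreal 2
  have ht : ((volume s).toReal ^ ((1 : ℝ) / 3)) ^ 2 = (volume s).toReal ^ ((2 : ℝ) / 3) := by
    rw [← rpow_mul_natCast ENNReal.toReal_nonneg]
    norm_num
  rw [sq_sqrt (by positivity), mul_pow, mul_pow, sq_sqrt (by positivity), ht] at hsq
  simp only [Real.norm_eq_abs, sq_abs] at hsq
  calc ∫ x, V x ^ 2
      ≤ (c : ℝ) ^ 2 * (∫ x, ‖fderiv ℝ V x‖ ^ 2) * (volume s).toReal ^ ((2 : ℝ) / 3) := hsq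
    _ ≤ (c : ℝ) ^ 2 * (∫ x, gradNormSq V x) * (volume s).toReal ^ ((2 : ℝ) / 3) := by gcongr
    _ = _ := by ring

theorem caccioppoli_estimate_zero_set :
    ∃ C : ℝ, 0 < C ∧
      ∀ (U : EuclideanSpace ℝ (Fin 3) → ℝ), ContDiff ℝ 2 U →
        (∀ x, 0 ≤ U x) → (∀ x, 0 ≤ laplacian U x) →
        ∀ (x₀ : EuclideanSpace ℝ (Fin 3)) (r : ℝ), 0 < r →
          (∫ x in Metric.ball x₀ r, (U x ^ 2 / r ^ 2 + gradNormSq U x)) ≤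
            C * ((volume (Metric.ball x₀ (2 * r) \ {x | U x = 0})).toReal /
                  (volume (Metric.ball x₀ r)).toReal) ^ ((2 : ℝ) / 3) *
              ∫ x in Metric.ball x₀ (2 * r),
                (U x ^ 2 / (4 * r ^ 2) + gradNormSq U x) := by
  obtain ⟨M₁, hM₁, hcut₁⟩ := exists_cutoff (a := 1) (b := 5 / 4) one_pos (by norm_num)
  obtain ⟨M₂, hM₂, hcut₂⟩ := exists_cutoff (a := 3 / 2) (b := 7 / 4) (by norm_num) (by norm_num)
  obtain ⟨S, hS, hsob⟩ := exists_integral_sq_le_rpow_volume_mul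
  set ω : ℝ := (volume (Metric.ball (0 : EuclideanSpace ℝ (Fin 3)) 1)).toReal with hω
  have hω0 : 0 < ω := ENNReal.toReal_pos (Metric.measure_ball_pos _ _ one_pos).ne'
    measure_ball_lt_top.ne
  refine ⟨(1 + 4 * M₁) * (S + 1) * (2 + 8 * M₂) * ω ^ ((2 : ℝ) / 3), by positivity,
    fun U hU hU0 hΔ x₀ r hr => ?_⟩
  obtain ⟨η, hη, -, -, hηone, hηsupp, hηgrad⟩ := hcut₁ x₀ r hr
  obtain ⟨φ, hφ, hφ0, hφ1, hφone, hφsupp, hφgrad⟩ := hcut₂ x₀ r hr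
  have hU1 : ContDiff ℝ 1 U := hU.of_le one_le_two
  have hηc : HasCompactSupport η :=
    (isCompact_closedBall x₀ _).of_isClosed_subset (isClosed_tsupport η) hηsupp
  have hφc : HasCompactSupport φ :=
    (isCompact_closedBall x₀ _).of_isClosed_subset (isClosed_tsupport φ) hφsupp
  have hη2 : HasCompactSupport fun x => η x ^ 2 := by
    simpa [Function.comp_def] using hηc.comp_left (g := fun t : ℝ => t ^ 2) (by simp)
  have hV : ContDiff ℝ 1 fun x => φ x * U x := hφ.mul hU1
  have hVc : HasCompactSupport fun x => φ x * U x := hφc.mul_right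
  have hV2 : HasCompactSupport fun x => (φ x * U x) ^ 2 := by
    simpa [Function.comp_def] using hVc.comp_left (g := fun t : ℝ => t ^ 2) (by simp)
  have hφsub : tsupport φ ⊆ Metric.ball x₀ (2 * r) :=
    hφsupp.trans (Metric.closedBall_subset_ball (by linarith))
  have hiV : Integrable fun x => (φ x * U x) ^ 2 :=
    (hV.continuous.pow 2).integrable_of_hasCompactSupport hV2
  have hiη : Integrable fun x => η x ^ 2 * gradNormSq U x :=
    ((hη.continuous.pow 2).mul (continuous_gradNormSq hU1)).integrable_of_hasCompactSupport
      hη2.mul_right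
  have hiUη : Integrable fun x => U x ^ 2 * gradNormSq η x :=
    ((hU.continuous.pow 2).mul (continuous_gradNormSq hη)).integrable_of_hasCompactSupport
      (hasCompactSupport_gradNormSq hηc).mul_left
  have hball (R c : ℝ) : IntegrableOn (fun x => U x ^ 2 / c + gradNormSq U x)
      (Metric.ball x₀ R) :=
    ((((hU.continuous.pow 2).div_const c).add
      (continuous_gradNormSq hU1)).continuousOn.integrableOn_compact
      (isCompact_closedBall x₀ R)).mono_set Metric.ball_subset_closedBall
  have hinner : ∫ x in Metric.ball x₀ r, (U x ^ 2 / r ^ 2 + gradNormSq U x) ≤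
      (∫ x, (φ x * U x) ^ 2) / r ^ 2 + ∫ x, η x ^ 2 * gradNormSq U x := by
    rw [← integral_div, ← integral_add (hiV.div_const _) hiη]
    calc ∫ x in Metric.ball x₀ r, (U x ^ 2 / r ^ 2 + gradNormSq U x)
        = ∫ x in Metric.ball x₀ r,
            ((φ x * U x) ^ 2 / r ^ 2 + η x ^ 2 * gradNormSq U x) := by
          refine setIntegral_congr_fun measurableSet_ball fun x hx => ?_
          have hx' : dist x x₀ < r := hx
          rw [hηone x (by rw [Metric.mem_closedBall]; linarith),
            hφone x (by rw [Metric.mem_closedBall]; linarith)]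
          ring
      _ ≤ _ := by
          refine setIntegral_le_integral ((hiV.div_const _).add hiη)
            (Filter.Eventually.of_forall fun x => ?_)
          have := gradNormSq_nonneg U x
          simp only [Pi.zero_apply]
          positivity
  have hcacc := caccioppoli hU hU0 hΔ hη hηc
  have hη_le : ∫ x, U x ^ 2 * gradNormSq η x ≤ M₁ / r ^ 2 * ∫ x, (φ x * U x) ^ 2 := by
    rw [← integral_const_mul]
    refine integral_mono hiUη (hiV.const_mul _) fun x => ?_
    simp only
    by_cases hx : x ∈ tsupport η
    · have hx' : dist x x₀ ≤ 5 / 4 * r := hηsupp hx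
      rw [hφone x (by rw [Metric.mem_closedBall]; linarith), one_mul, mul_comm]
      gcongr
      exact hηgrad x
    · rw [gradNormSq_eq_zero_of_notMem_tsupport hx, mul_zero]
      positivity
  have hfk := hsob _ hV hVc (Metric.ball x₀ (2 * r) \ {x | U x = 0})
    (fun x hx => ⟨hφsub (subset_tsupport _ (left_ne_zero_of_mul hx)), right_ne_zero_of_mul hx⟩)
    ((measure_mono Set.sdiff_subset).trans_lt measure_ball_lt_top).ne
  have hgrad : ∫ x, gradNormSq (fun y => φ y * U y) x ≤ (2 + 8 * M₂) *
      ∫ x in Metric.ball x₀ (2 * r), (U x ^ 2 / (4 * r ^ 2) + gradNormSq U x) := by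
    rw [← integral_const_mul, ← setIntegral_eq_integral_of_forall_compl_eq_zero
      (s := Metric.ball x₀ (2 * r))]
    · refine setIntegral_mono ((continuous_gradNormSq hV).integrable_of_hasCompactSupport
        (hasCompactSupport_gradNormSq hVc)).integrableOn ((hball _ _).const_mul _) fun x => ?_
      have hG := gradNormSq_nonneg U x
      calc gradNormSq (fun y => φ y * U y) x
          ≤ 2 * (φ x ^ 2 * gradNormSq U x + U x ^ 2 * gradNormSq φ x) :=
            gradNormSq_mul_le hφ hU1 x
        _ ≤ 2 * (1 * gradNormSq U x + U x ^ 2 * (M₂ / r ^ 2)) := by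
            gcongr
            · exact pow_le_one₀ (hφ0 x) (hφ1 x)
            · exact hφgrad x
        _ = 2 * gradNormSq U x + 8 * M₂ * (U x ^ 2 / (4 * r ^ 2)) := by
            field_simp
            ring
        _ ≤ (2 + 8 * M₂) * (U x ^ 2 / (4 * r ^ 2) + gradNormSq U x) := by
            have h1 : 0 ≤ U x ^ 2 / (4 * r ^ 2) := by positivity
            have h2 : 0 ≤ M₂ * gradNormSq U x := by positivity
            linarith
    · intro x hx
      exact gradNormSq_eq_zero_of_notMem_tsupport fun h =>
        hx (hφsub (closure_mono (fun y hy => left_ne_zero_of_mul hy) h))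
  set J := ∫ x in Metric.ball x₀ (2 * r), (U x ^ 2 / (4 * r ^ 2) + gradNormSq U x)
  have hJ0 : 0 ≤ J := integral_nonneg fun x =>
    add_nonneg (by positivity) (gradNormSq_nonneg U x)
  set v := (volume (Metric.ball x₀ (2 * r) \ {x | U x = 0})).toReal
  have hv0 : 0 ≤ v := ENNReal.toReal_nonneg
  have hvol : (volume (Metric.ball x₀ r)).toReal = r ^ 3 * ω := by
    rw [Measure.addHaar_ball_of_pos _ _ hr, ENNReal.toReal_mul,
      ENNReal.toReal_ofReal (by positivity)]
    simp [hω]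
  have hpow : (v / (r ^ 3 * ω)) ^ ((2 : ℝ) / 3) =
      v ^ ((2 : ℝ) / 3) / (r ^ 2 * ω ^ ((2 : ℝ) / 3)) := by
    rw [div_rpow hv0 (by positivity), mul_rpow (by positivity) hω0.le,
      ← rpow_natCast_mul hr.le]
    norm_num
  rw [hvol, hpow]
  have hωp : 0 < ω ^ ((2 : ℝ) / 3) := by positivity
  calc ∫ x in Metric.ball x₀ r, (U x ^ 2 / r ^ 2 + gradNormSq U x)
      ≤ (∫ x, (φ x * U x) ^ 2) / r ^ 2 + 4 * (M₁ / r ^ 2 * ∫ x, (φ x * U x) ^ 2) := by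
        linarith
    _ = (1 + 4 * M₁) / r ^ 2 * ∫ x, (φ x * U x) ^ 2 := by ring
    _ ≤ (1 + 4 * M₁) / r ^ 2 *
          ((S + 1) * v ^ ((2 : ℝ) / 3) * ((2 + 8 * M₂) * J)) := by
        gcongr
        refine hfk.trans (mul_le_mul ?_ hgrad
          (integral_nonneg (gradNormSq_nonneg _)) (by positivity))
        gcongr
        linarith
    _ = _ := by
        field_simp
end

section
/- There exists ε₀ ∈ (0,1] such that for every ε ∈ (0,ε₀] and every z ∈ ℝ³∖{0}, the 4×4 complex matrix M_ε(z) := −i·(1−e^{−√ε‖z‖})·(4π‖z‖³)⁻¹·(α·z) − i·√ε·e^{−√ε‖z‖}·(4π‖z‖²)⁻¹·(α·z) + ε·e^{−√ε‖z‖}·(4π‖z‖)⁻¹·β satisfies ‖M_ε(z)‖ ≤ 3·ε^{1/4}·(4π‖z‖^{3/2})⁻¹, where ‖·‖ is the operator norm on ℂ⁴ with the Euclidean inner product. (M_ε(z) is the integral kernel, evaluated at z = x−y, of the resolvent difference (α·p+εβ)⁻¹ − (α·p)⁻¹.) -/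
open MeasureTheory Real

/-- The Pauli matrices. -/
noncomputable def pauli : Fin 3 → Matrix (Fin 2) (Fin 2) ℂ :=
  ![!![0, 1; 1, 0], !![0, -Complex.I; Complex.I, 0], !![1, 0; 0, -1]]

/-- The Dirac matrices `αⱼ = [[0, σⱼ], [σⱼ, 0]]`. -/
noncomputable def diracAlpha (j : Fin 3) : Matrix (Fin 4) (Fin 4) ℂ :=
  (Matrix.reindex finSumFinEquiv finSumFinEquiv
    (Matrix.fromBlocks 0 (pauli j) (pauli j) 0) : Matrix (Fin 4) (Fin 4) ℂ)

/-- The Dirac matrix `β = [[I₂, 0], [0, -I₂]]`. -/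
noncomputable def diracBeta : Matrix (Fin 4) (Fin 4) ℂ :=
  (Matrix.reindex finSumFinEquiv finSumFinEquiv
    (Matrix.fromBlocks (1 : Matrix (Fin 2) (Fin 2) ℂ) 0 0 (-1 : Matrix (Fin 2) (Fin 2) ℂ)) : Matrix (Fin 4) (Fin 4) ℂ)

/-- `α·v = ∑ⱼ vⱼ αⱼ` for `v ∈ ℝ³`. -/
noncomputable def alphaDot (v : EuclideanSpace ℝ (Fin 3)) :
    Matrix (Fin 4) (Fin 4) ℂ :=
  ∑ j : Fin 3, ((v j : ℝ) : ℂ) • diracAlpha j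

/-- The operator norm of a `4 × 4` complex matrix acting on `ℂ⁴` with its
Euclidean inner product. -/
noncomputable def opNorm (M : Matrix (Fin 4) (Fin 4) ℂ) : ℝ :=
  ‖LinearMap.toContinuousLinearMap (Matrix.toEuclideanLin M)‖

/-- The kernel (at `z = x - y`) of `(α·p + εβ)⁻¹ - (α·p)⁻¹`. -/
noncomputable def resolventDiffKernel (ε : ℝ) (z : EuclideanSpace ℝ (Fin 3)) :
    Matrix (Fin 4) (Fin 4) ℂ :=
  (-Complex.I * (((1 - Real.exp (-(Real.sqrt ε * ‖z‖))) /
      (4 * π * ‖z‖ ^ 3) : ℝ) : ℂ)) • alphaDot z +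
  (-Complex.I * ((Real.sqrt ε * Real.exp (-(Real.sqrt ε * ‖z‖)) /
      (4 * π * ‖z‖ ^ 2) : ℝ) : ℂ)) • alphaDot z +
  (((ε * Real.exp (-(Real.sqrt ε * ‖z‖)) / (4 * π * ‖z‖) : ℝ) : ℂ)) • diracBeta

open scoped Matrix.Norms.L2Operator in
theorem opNorm_eq_l2_opNorm (M : Matrix (Fin 4) (Fin 4) ℂ) : opNorm M = ‖M‖ :=
  (Matrix.l2_opNorm_def M).symm

theorem diracBeta_conjTranspose_mul_self : diracBeta.conjTranspose * diracBeta = 1 := by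
  have hβ : diracBeta = !![1, 0, 0, 0; 0, 1, 0, 0; 0, 0, -1, 0; 0, 0, 0, -1] := by
    ext i j
    fin_cases i <;> fin_cases j <;>
      simp [diracBeta, finSumFinEquiv, Fin.addCases]
  rw [hβ]
  ext i j
  fin_cases i <;> fin_cases j <;> simp [Matrix.mul_apply, Fin.sum_univ_four]

theorem alphaDot_eq (v : EuclideanSpace ℝ (Fin 3)) :
    alphaDot v = !![0, 0, (v 2 : ℂ), v 0 - Complex.I * v 1;
      0, 0, v 0 + Complex.I * v 1, -v 2;
      (v 2 : ℂ), v 0 - Complex.I * v 1, 0, 0;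
      v 0 + Complex.I * v 1, -v 2, 0, 0] := by
  ext i j
  fin_cases i <;> fin_cases j <;>
    simp [alphaDot, diracAlpha, pauli, finSumFinEquiv, Fin.addCases, Fin.sum_univ_three,
      Matrix.add_apply] <;> ring

theorem alphaDot_conjTranspose_mul_self (v : EuclideanSpace ℝ (Fin 3)) :
    (alphaDot v).conjTranspose * alphaDot v = ((‖v‖ ^ 2 : ℝ) : ℂ) • 1 := by
  rw [alphaDot_eq, EuclideanSpace.norm_sq_eq]
  ext i j
  fin_cases i <;> fin_cases j <;>
    simp [Matrix.mul_apply, Fin.sum_univ_four, Fin.sum_univ_three] <;>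
    ring_nf <;> simp [Complex.I_sq]

open scoped Matrix.Norms.L2Operator in
theorem opNorm_diracBeta : opNorm diracBeta = 1 := by
  rw [opNorm_eq_l2_opNorm]
  have h := Matrix.l2_opNorm_conjTranspose_mul_self diracBeta
  rw [diracBeta_conjTranspose_mul_self, CStarRing.norm_one] at h
  nlinarith [norm_nonneg diracBeta]

open scoped Matrix.Norms.L2Operator in
theorem opNorm_alphaDot (v : EuclideanSpace ℝ (Fin 3)) : opNorm (alphaDot v) = ‖v‖ := by
  rw [opNorm_eq_l2_opNorm]
  have h := Matrix.l2_opNorm_conjTranspose_mul_self (alphaDot v)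
  rw [alphaDot_conjTranspose_mul_self, norm_smul, CStarRing.norm_one, Complex.norm_real,
    Real.norm_of_nonneg (by positivity), mul_one, sq] at h
  exact ((mul_self_inj (norm_nonneg _) (norm_nonneg _)).1 h).symm

theorem opNorm_add_le (M N : Matrix (Fin 4) (Fin 4) ℂ) :
    opNorm (M + N) ≤ opNorm M + opNorm N := by
  simpa only [opNorm, map_add] using norm_add_le _ _

theorem opNorm_smul (c : ℂ) (M : Matrix (Fin 4) (Fin 4) ℂ) :
    opNorm (c • M) = ‖c‖ * opNorm M := by
  simp only [opNorm, map_smul, norm_smul]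

theorem opNorm_resolventDiffKernel_le {ε : ℝ} (hε : 0 ≤ ε) (z : EuclideanSpace ℝ (Fin 3)) :
    opNorm (resolventDiffKernel ε z) ≤
      (1 - exp (-(√ε * ‖z‖))) / (4 * π * ‖z‖ ^ 3) * ‖z‖ +
      √ε * exp (-(√ε * ‖z‖)) / (4 * π * ‖z‖ ^ 2) * ‖z‖ +
      ε * exp (-(√ε * ‖z‖)) / (4 * π * ‖z‖) := by
  have hexp : 0 ≤ 1 - exp (-(√ε * ‖z‖)) := by
    rw [sub_nonneg, exp_le_one_iff, neg_nonpos]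
    positivity
  refine (opNorm_add_le _ _).trans ((add_le_add_left (opNorm_add_le _ _) _).trans_eq ?_)
  simp only [opNorm_smul, opNorm_alphaDot, opNorm_diracBeta, norm_mul, norm_neg, Complex.norm_I,
    Complex.norm_real, one_mul, mul_one]
  rw [Real.norm_of_nonneg (by positivity), Real.norm_of_nonneg (by positivity),
    Real.norm_of_nonneg (by positivity)]

/-- With `u = √t`, the three profiles `1 - e⁻ᵗ`, `t e⁻ᵗ` and `s t e⁻ᵗ` are each at most `√t`. -/
theorem one_sub_exp_add_le {s u : ℝ} (hs : s ≤ 1) (hu : 0 ≤ u) :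
    1 - exp (-u ^ 2) + u ^ 2 * exp (-u ^ 2) + s * (u ^ 2 * exp (-u ^ 2)) ≤ 3 * u := by
  have hpos := exp_pos (-u ^ 2)
  have h₁ : 1 - exp (-u ^ 2) ≤ u := by
    rcases le_total u 1 with h | h
    · nlinarith [add_one_le_exp (-u ^ 2)]
    · linarith
  have h₂ : u * exp (-u ^ 2) ≤ 1 := by
    rw [exp_neg, ← div_eq_mul_inv, div_le_one (exp_pos _)]
    nlinarith [add_one_le_exp (u ^ 2), sq_nonneg (u - 1)]
  have h₃ : u ^ 2 * exp (-u ^ 2) ≤ u := by nlinarith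
  have h₄ : s * (u ^ 2 * exp (-u ^ 2)) ≤ u ^ 2 * exp (-u ^ 2) :=
    mul_le_of_le_one_left (by positivity) hs
  linarith

theorem resolvent_difference_kernel_bound :
    ∃ ε₀ : ℝ, 0 < ε₀ ∧ ε₀ ≤ 1 ∧
      ∀ ε : ℝ, 0 < ε → ε ≤ ε₀ →
        ∀ z : EuclideanSpace ℝ (Fin 3), z ≠ 0 →
          opNorm (resolventDiffKernel ε z) ≤
            3 * ε ^ ((1 : ℝ) / 4) / (4 * π * ‖z‖ ^ ((3 : ℝ) / 2)) := by
  refine ⟨1, one_pos, le_rfl, fun ε hε hε₁ z hz => ?_⟩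
  refine (opNorm_resolventDiffKernel_le hε.le z).trans ?_
  have hr : 0 < ‖z‖ := norm_pos_iff.2 hz
  set r := ‖z‖
  obtain ⟨q, hq⟩ : ∃ q, q = ε ^ ((1 : ℝ) / 4) := ⟨_, rfl⟩
  have hq₀ : 0 < q := hq ▸ rpow_pos_of_pos hε _
  have hqε : q ^ 4 = ε := by
    rw [hq, ← rpow_natCast, ← rpow_mul hε.le]
    norm_num
  have hsε : √ε = q ^ 2 := by
    rw [← hqε, show q ^ 4 = (q ^ 2) ^ 2 by ring, sqrt_sq (by positivity)]
  obtain ⟨w, hw⟩ : ∃ w, w = √r := ⟨_, rfl⟩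
  have hw₀ : 0 < w := hw ▸ sqrt_pos.2 hr
  have hwr : r = w ^ 2 := by rw [hw, sq_sqrt hr.le]
  have hr32 : r ^ ((3 : ℝ) / 2) = w ^ 3 := by
    rw [hw, sqrt_eq_rpow, ← rpow_natCast, ← rpow_mul hr.le]
    norm_num
  have hs : q ^ 2 ≤ 1 := hsε ▸ sqrt_le_one.2 hε₁
  have key := one_sub_exp_add_le hs (mul_pos hq₀ hw₀).le
  rw [hr32, ← hq, hsε, hwr, ← mul_pow]
  rw [← hqε]
  generalize exp (-(q * w) ^ 2) = e at key ⊢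
  calc _ = (1 - e + (q * w) ^ 2 * e + q ^ 2 * ((q * w) ^ 2 * e)) / (4 * π * w ^ 4) := by
        field_simp
    _ ≤ 3 * (q * w) / (4 * π * w ^ 4) := by gcongr
    _ = _ := by field_simp
end

section
/- (Kato's inequality for the Coulomb potential of a measure.) For every nonnegative finite Borel measure μ on ℝ³ and every smooth compactly supported φ : ℝ³ → ℂ, one has ∫_{ℝ³} V_μ(x)·|φ(x)|² dx ≤ π²·μ(ℝ³)·∫_{ℝ³} ‖ξ‖·|(𝓕φ)(ξ)|² dξ. (This is the quadratic-form version of the operator bound V_μ ≤ (π/2)·μ(ℝ³)·|p|.) -/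
open MeasureTheory Real FourierTransform

section KatoInequality

open Set
open scoped SchwartzMap ComplexConjugate RealInnerProductSpace

theorem lintegral_Ioi_gaussian {c : ℝ} (hc : 0 < c) :
    ∫⁻ s in Ioi (0 : ℝ), ENNReal.ofReal (exp (-(π * c ^ 2) * s ^ 2)) =
      ENNReal.ofReal (2 * c)⁻¹ := by
  have hb : 0 < π * c ^ 2 := by positivity
  rw [← ofReal_integral_eq_lintegral_ofReal (integrable_exp_neg_mul_sq hb).integrableOn
    (ae_of_all _ fun _ => (exp_pos _).le), integral_gaussian_Ioi]
  congr 1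
  have : π / (π * c ^ 2) = c⁻¹ ^ 2 := by field_simp
  rw [this, sqrt_sq (by positivity)]
  field_simp

theorem lintegral_Ioi_comp_inv (g : ℝ → ENNReal) :
    ∫⁻ s in Ioi (0 : ℝ), ENNReal.ofReal ((s ^ 2)⁻¹) * g s⁻¹ = ∫⁻ s in Ioi (0 : ℝ), g s := by
  have h := lintegral_image_eq_lintegral_abs_deriv_mul (s := Ioi (0 : ℝ)) (f := fun s => s⁻¹)
    (f' := fun s => -(s ^ 2)⁻¹) measurableSet_Ioi
    (fun x hx => (hasDerivAt_inv (ne_of_gt hx)).hasDerivWithinAt) inv_injective.injOn g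
  have himg : (fun s : ℝ => s⁻¹) '' Ioi 0 = Ioi 0 := by
    rw [image_inv_eq_inv]
    ext s
    simp
  rw [himg] at h
  simpa using h.symm

theorem lintegral_Ioi_comp_mul_left {a : ℝ} (ha : 0 < a) (g : ℝ → ENNReal) :
    ∫⁻ s in Ioi (0 : ℝ), ENNReal.ofReal a * g (a * s) = ∫⁻ s in Ioi (0 : ℝ), g s := by
  have h := lintegral_image_eq_lintegral_abs_deriv_mul (s := Ioi (0 : ℝ)) (f := fun s => a * s)
    (f' := fun _ => a) measurableSet_Ioi
    (fun x _ => by simpa using ((hasDerivAt_id x).const_mul a).hasDerivWithinAt)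
    (mul_right_injective₀ ha.ne').injOn g
  rw [image_mul_left_Ioi ha, mul_zero, abs_of_pos ha] at h
  exact h.symm

theorem lintegral_Ioi_inv_sq_mul_gaussian_inv {c : ℝ} (hc : 0 < c) :
    ∫⁻ s in Ioi (0 : ℝ), ENNReal.ofReal ((s ^ 2)⁻¹ * exp (-(π / s ^ 2) * c ^ 2)) =
      ENNReal.ofReal (2 * c)⁻¹ := by
  rw [← lintegral_Ioi_gaussian hc,
    ← lintegral_Ioi_comp_inv fun s => ENNReal.ofReal (exp (-(π * c ^ 2) * s ^ 2))]
  congr 1 with s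
  rw [← ENNReal.ofReal_mul (by positivity)]
  congr 3
  rw [inv_pow]
  ring

/-- A Gaussian superposition equal to `1 / (π r²)` away from `r = 0`. -/
noncomputable def invSqKernel (r : ℝ) : ENNReal :=
  ∫⁻ s in Ioi (0 : ℝ), ENNReal.ofReal (2 * s * exp (-(π * r ^ 2) * s ^ 2))

@[fun_prop]
theorem measurable_invSqKernel : Measurable invSqKernel := by
  unfold invSqKernel
  exact Measurable.lintegral_prod_right' (f := fun p : ℝ × ℝ =>
    ENNReal.ofReal (2 * p.2 * exp (-(π * p.1 ^ 2) * p.2 ^ 2))) (by fun_prop)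

theorem invSqKernel_eq {r : ℝ} (hr : 0 < r) :
    invSqKernel r = ENNReal.ofReal (π * r ^ 2)⁻¹ := by
  set b := π * r ^ 2 with hb
  have hb0 : 0 < b := by positivity
  have hd : ∀ s ∈ Ici (0 : ℝ),
      HasDerivAt (fun s => -b⁻¹ * exp (-b * s ^ 2)) (2 * s * exp (-b * s ^ 2)) s := by
    intro s _
    refine ((((hasDerivAt_pow 2 s).const_mul (-b)).exp).const_mul (-b⁻¹)).congr_deriv ?_
    field_simp
    norm_num
    ring
  have hpos : ∀ s ∈ Ioi (0 : ℝ), 0 ≤ 2 * s * exp (-b * s ^ 2) := fun s hs => by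
    have : 0 < s := hs
    positivity
  have ht : Filter.Tendsto (fun s => -b⁻¹ * exp (-b * s ^ 2)) Filter.atTop (nhds 0) := by
    have h := ((Filter.tendsto_pow_atTop (α := ℝ) two_ne_zero).const_mul_atTop_of_neg
      (neg_neg_of_pos hb0))
    simpa using (tendsto_exp_atBot.comp h).const_mul (-b⁻¹)
  unfold invSqKernel
  rw [← ofReal_integral_eq_lintegral_ofReal (integrableOn_Ioi_deriv_of_nonneg' hd hpos ht)
    (ae_restrict_of_forall_mem measurableSet_Ioi hpos),
    integral_Ioi_of_hasDerivAt_of_nonneg' hd hpos ht]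
  simp

theorem lintegral_Ioi_inv_one_add_sq :
    ∫⁻ v in Ioi (0 : ℝ), ENNReal.ofReal (1 + v ^ 2)⁻¹ = ENNReal.ofReal (π / 2) := by
  rw [← ofReal_integral_eq_lintegral_ofReal integrable_inv_one_add_sq.integrableOn
    (ae_of_all _ fun _ => by positivity), integral_Ioi_inv_one_add_sq]
  simp

local notation "E3" => EuclideanSpace ℝ (Fin 3)

theorem integrable_gaussian_euclidean {b : ℝ} (hb : 0 < b) :
    Integrable fun v : E3 => exp (-b * ‖v‖ ^ 2) := by
  have := (GaussianFourier.integrable_cexp_neg_mul_sq_norm_add (b := (b : ℂ)) (by simpa) 0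
    (0 : E3)).norm
  simpa [Complex.norm_exp, ← Complex.ofReal_pow] using this

theorem lintegral_gaussian_euclidean {b : ℝ} (hb : 0 < b) (a : E3) :
    ∫⁻ v : E3, ENNReal.ofReal (exp (-b * ‖v - a‖ ^ 2)) =
      ENNReal.ofReal ((π / b) ^ (3 / 2 : ℝ)) := by
  rw [lintegral_sub_right_eq_self (fun v : E3 => ENNReal.ofReal (exp (-b * ‖v‖ ^ 2))),
    ← ofReal_integral_eq_lintegral_ofReal (integrable_gaussian_euclidean hb)
    (ae_of_all _ fun _ => (exp_pos _).le), GaussianFourier.integral_rexp_neg_mul_sq_norm hb]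
  simp

theorem lintegral_gaussian_mul_gaussian {s v : ℝ} (hs : 0 < s) (ξ : E3) :
    ∫⁻ η : E3, ENNReal.ofReal (exp (-(π * s ^ 2) * (‖η‖ ^ 2 + v ^ 2 * ‖ξ - η‖ ^ 2))) =
      ENNReal.ofReal ((s * √(1 + v ^ 2))⁻¹ ^ 3 *
        exp (-(π * (v * ‖ξ‖ / √(1 + v ^ 2)) ^ 2) * s ^ 2)) := by
  have hv : 0 < 1 + v ^ 2 := by positivity
  have hsq : √(1 + v ^ 2) ^ 2 = 1 + v ^ 2 := sq_sqrt hv.le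
  have hsq0 : 0 < √(1 + v ^ 2) := sqrt_pos.2 hv
  have key (η : E3) : exp (-(π * s ^ 2) * (‖η‖ ^ 2 + v ^ 2 * ‖ξ - η‖ ^ 2)) =
      exp (-(π * (v * ‖ξ‖ / √(1 + v ^ 2)) ^ 2) * s ^ 2) *
        exp (-(π * s ^ 2 * (1 + v ^ 2)) * ‖η - (v ^ 2 / (1 + v ^ 2)) • ξ‖ ^ 2) := by
    rw [← exp_add]
    congr 1
    rw [norm_sub_sq_real, norm_sub_sq_real, norm_smul, inner_smul_right, real_inner_comm,
      div_pow, hsq, norm_of_nonneg (by positivity)]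
    field_simp
    ring
  simp_rw [key, ENNReal.ofReal_mul (exp_pos _).le]
  rw [lintegral_const_mul _ (by fun_prop), lintegral_gaussian_euclidean (by positivity),
    mul_comm, ENNReal.ofReal_mul (by positivity)]
  congr 2
  have : π / (π * s ^ 2 * (1 + v ^ 2)) = (s * √(1 + v ^ 2))⁻¹ ^ 2 := by
    rw [inv_pow, mul_pow, hsq]
    field_simp
  rw [this, ← rpow_natCast, ← rpow_natCast, ← rpow_mul (by positivity)]
  norm_num

theorem lintegral_Ioi_lintegral_gaussian {v : ℝ} (hv : 0 < v) {ξ : E3} (hξ : ξ ≠ 0) :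
    ∫⁻ s in Ioi (0 : ℝ), ∫⁻ η : E3, ENNReal.ofReal (4 * s ^ 3 * v *
      exp (-(π * s ^ 2) * (‖η‖ ^ 2 + v ^ 2 * ‖ξ - η‖ ^ 2))) =
      ENNReal.ofReal (2 / ‖ξ‖) * ENNReal.ofReal (1 + v ^ 2)⁻¹ := by
  have hξ' : 0 < ‖ξ‖ := norm_pos_iff.2 hξ
  have hsq : √(1 + v ^ 2) ^ 2 = 1 + v ^ 2 := sq_sqrt (by positivity)
  have hsq0 : 0 < √(1 + v ^ 2) := sqrt_pos.2 (by positivity)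
  have key : ∀ s ∈ Ioi (0 : ℝ), ∫⁻ η : E3, ENNReal.ofReal (4 * s ^ 3 * v *
      exp (-(π * s ^ 2) * (‖η‖ ^ 2 + v ^ 2 * ‖ξ - η‖ ^ 2))) =
      ENNReal.ofReal (4 * v / √(1 + v ^ 2) ^ 3) *
        ENNReal.ofReal (exp (-(π * (v * ‖ξ‖ / √(1 + v ^ 2)) ^ 2) * s ^ 2)) := by
    intro s hs
    have hs : 0 < s := hs
    simp_rw [ENNReal.ofReal_mul (show 0 ≤ 4 * s ^ 3 * v by positivity)]
    rw [lintegral_const_mul _ (by fun_prop), lintegral_gaussian_mul_gaussian hs,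
      ← ENNReal.ofReal_mul (by positivity), ← ENNReal.ofReal_mul (by positivity), ← mul_assoc]
    congr 2
    field_simp
  rw [setLIntegral_congr_fun measurableSet_Ioi key, lintegral_const_mul _ (by fun_prop),
    lintegral_Ioi_gaussian (by positivity), ← ENNReal.ofReal_mul (by positivity),
    ← ENNReal.ofReal_mul (by positivity)]
  congr 1
  have h : (1 + v ^ 2)⁻¹ = (√(1 + v ^ 2) ^ 2)⁻¹ := by rw [hsq]
  rw [h]
  field_simp
  ring

theorem invSqKernel_mul_invSqKernel (p q : ℝ) :
    invSqKernel p * invSqKernel q = ∫⁻ s in Ioi (0 : ℝ), ∫⁻ v in Ioi (0 : ℝ),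
      ENNReal.ofReal (4 * s ^ 3 * v * exp (-(π * s ^ 2) * (p ^ 2 + v ^ 2 * q ^ 2))) := by
  rw [invSqKernel, ← lintegral_mul_const _ (by fun_prop)]
  refine setLIntegral_congr_fun measurableSet_Ioi fun s hs => ?_
  have hs : 0 < s := hs
  rw [invSqKernel, ← lintegral_Ioi_comp_mul_left hs, ← lintegral_const_mul _ (by fun_prop)]
  refine setLIntegral_congr_fun measurableSet_Ioi fun v hv => ?_
  have hv : 0 < v := hv
  rw [← ENNReal.ofReal_mul (by positivity), ← ENNReal.ofReal_mul (by positivity)]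
  congr 1
  have : -(π * s ^ 2) * (p ^ 2 + v ^ 2 * q ^ 2) =
    -(π * p ^ 2) * s ^ 2 + -(π * q ^ 2) * (s * v) ^ 2 := by ring
  rw [this, exp_add]
  ring

theorem lintegral_invSqKernel_mul_invSqKernel {ξ : E3} (hξ : ξ ≠ 0) :
    ∫⁻ η : E3, invSqKernel ‖η‖ * invSqKernel ‖ξ - η‖ = ENNReal.ofReal (π / ‖ξ‖) := by
  have hξ' : 0 < ‖ξ‖ := norm_pos_iff.2 hξ
  simp_rw [invSqKernel_mul_invSqKernel]
  let F : E3 × ℝ × ℝ → ENNReal := fun p => ENNReal.ofReal (4 * p.2.1 ^ 3 * p.2.2 *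
    exp (-(π * p.2.1 ^ 2) * (‖p.1‖ ^ 2 + p.2.2 ^ 2 * ‖ξ - p.1‖ ^ 2)))
  have hF : Measurable F := by fun_prop
  calc ∫⁻ η : E3, ∫⁻ s in Ioi (0 : ℝ), ∫⁻ v in Ioi (0 : ℝ), F (η, s, v)
      = ∫⁻ η : E3, ∫⁻ v in Ioi (0 : ℝ), ∫⁻ s in Ioi (0 : ℝ), F (η, s, v) := by
        congr 1 with η
        exact lintegral_lintegral_swap (by unfold Function.uncurry; fun_prop)
    _ = ∫⁻ v in Ioi (0 : ℝ), ∫⁻ η : E3, ∫⁻ s in Ioi (0 : ℝ), F (η, s, v) := by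
        refine lintegral_lintegral_swap (Measurable.aemeasurable ?_)
        exact Measurable.lintegral_prod_right' (f := fun q : (E3 × ℝ) × ℝ => F (q.1.1, q.2, q.1.2))
          (by fun_prop)
    _ = ∫⁻ v in Ioi (0 : ℝ), ∫⁻ s in Ioi (0 : ℝ), ∫⁻ η : E3, F (η, s, v) := by
        congr 1 with v
        exact lintegral_lintegral_swap (by unfold Function.uncurry; fun_prop)
    _ = ∫⁻ v in Ioi (0 : ℝ), ENNReal.ofReal (2 / ‖ξ‖) * ENNReal.ofReal (1 + v ^ 2)⁻¹ :=
        setLIntegral_congr_fun measurableSet_Ioi fun v hv =>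
          lintegral_Ioi_lintegral_gaussian hv hξ
    _ = ENNReal.ofReal (π / ‖ξ‖) := by
        rw [lintegral_const_mul _ (by fun_prop), lintegral_Ioi_inv_one_add_sq,
          ← ENNReal.ofReal_mul (by positivity)]
        congr 1
        field_simp

theorem fourier_conj_fourier (f : 𝓢(E3, ℂ)) (x : E3) :
    𝓕 (fun η => conj (𝓕 (f : E3 → ℂ) η)) x = conj (f x) := by
  have h : 𝓕⁻ (𝓕 (f : E3 → ℂ)) x = f x :=
    f.integrable.fourierInv_fourier_eq (by simpa [SchwartzMap.fourier_coe] using (𝓕 f).integrable)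
      f.continuous.continuousAt
  rw [← h, fourier_eq', fourierInv_eq', ← integral_conj]
  congr 1 with η
  simp only [smul_eq_mul, map_mul, ← Complex.exp_conj, Complex.conj_ofReal, Complex.conj_I]
  congr 2
  push_cast
  ring

theorem norm_fourier_gaussian {s : ℝ} (hs : 0 < s) (ξ η : E3) :
    ‖𝓕 (fun x : E3 => Complex.exp (-((π / s ^ 2 : ℝ) : ℂ) * ‖x‖ ^ 2 +
      2 * π * Complex.I * ⟪ξ, x⟫)) η‖ = s ^ 3 * exp (-(π * ‖ξ - η‖ ^ 2) * s ^ 2) := by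
  have hb : 0 < π / s ^ 2 := by positivity
  rw [fourier_gaussian_innerProductSpace' (by rwa [Complex.ofReal_re])]
  have h1 : ((π : ℂ) / ((π / s ^ 2 : ℝ) : ℂ)) ^ (Module.finrank ℝ E3 / 2 : ℂ) =
      ((s ^ 3 : ℝ) : ℂ) := by
    have : (π : ℂ) / ((π / s ^ 2 : ℝ) : ℂ) = ((s ^ 2 : ℝ) : ℂ) := by
      rw [← Complex.ofReal_div]
      congr 1
      field_simp
    rw [this]
    have h2 : (Module.finrank ℝ E3 / 2 : ℂ) = ((3 / 2 : ℝ) : ℂ) := by simp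
    rw [h2, ← Complex.ofReal_cpow (by positivity), ← rpow_natCast, ← rpow_natCast,
      ← rpow_mul hs.le]
    norm_num
  have h3 : (-(π : ℂ) ^ 2 * ‖ξ - η‖ ^ 2 / ((π / s ^ 2 : ℝ) : ℂ)) =
      ((-(π * ‖ξ - η‖ ^ 2) * s ^ 2 : ℝ) : ℂ) := by
    push_cast
    have : (s : ℂ) ≠ 0 := by exact_mod_cast hs.ne'
    have : (π : ℂ) ≠ 0 := by exact_mod_cast pi_ne_zero
    field_simp
  rw [h1, h3, ← Complex.ofReal_exp, ← Complex.ofReal_mul, Complex.norm_real,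
    norm_of_nonneg (by positivity)]

theorem integral_fourier_mul_eq_flip {f g : E3 → ℂ} (hf : Integrable f) (hg : Integrable g) :
    ∫ x, 𝓕 f x * g x = ∫ x, f x * 𝓕 g x := by
  simpa using! VectorFourier.integral_fourierIntegral_smul_eq_flip (L := innerₗ E3)
    Real.continuous_fourierChar continuous_inner hf hg

theorem lintegral_norm_sq_mul_gaussian_le (f : 𝓢(E3, ℂ)) {s : ℝ} (hs : 0 < s) :
    ∫⁻ x, ‖f x‖ₑ ^ 2 * ENNReal.ofReal (exp (-(π / s ^ 2) * ‖x‖ ^ 2)) ≤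
      ∫⁻ ξ : E3, ∫⁻ η : E3, ‖𝓕 (f : E3 → ℂ) ξ‖ₑ * ‖𝓕 (f : E3 → ℂ) η‖ₑ *
        ENNReal.ofReal (s ^ 3 * exp (-(π * ‖ξ - η‖ ^ 2) * s ^ 2)) := by
  have hb : 0 < π / s ^ 2 := by positivity
  set b : ℝ := π / s ^ 2
  set ψ : E3 → ℂ := fun η => conj (𝓕 (f : E3 → ℂ) η) with hψdef
  have hψ : Integrable ψ := by
    have : Integrable (𝓕 (f : E3 → ℂ)) := by simpa [SchwartzMap.fourier_coe] using (𝓕 f).integrable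
    exact (LinearIsometryEquiv.integrable_comp_iff Complex.conjLIE).2 this
  have hψF : 𝓕 ψ = fun x => conj (f x) := funext (fourier_conj_fourier f)
  set G : E3 → E3 → ℂ := fun ξ x => Complex.exp (-(b : ℂ) * ‖x‖ ^ 2 +
      2 * π * Complex.I * ⟪ξ, x⟫) with hG
  have hGi (ξ : E3) : Integrable (G ξ) :=
    GaussianFourier.integrable_cexp_neg_mul_sq_norm_add (by simpa) _ _
  set g : E3 → ℂ := fun x => (exp (-b * ‖x‖ ^ 2) : ℂ) with hg
  have hfg : Integrable fun x => f x * g x := by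
    refine f.integrable.mul_bdd (c := 1) (by fun_prop) (ae_of_all _ fun x => ?_)
    have : -b * ‖x‖ ^ 2 ≤ 0 := by nlinarith [sq_nonneg ‖x‖]
    simpa [hg, Complex.norm_exp, ← Complex.ofReal_pow] using this
  have hflip (ξ : E3) : 𝓕 (fun x => f x * g x) ξ = conj (∫ x, ψ x * 𝓕 (G ξ) x) := by
    rw [← integral_fourier_mul_eq_flip hψ (hGi ξ), ← integral_conj, fourier_eq']
    congr 1 with x
    rw [hψF]
    have hc : conj (2 : ℂ) = 2 := Complex.conj_ofReal 2
    simp only [hG, hg, smul_eq_mul, map_mul, Complex.conj_conj, ← Complex.exp_conj,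
      map_neg, Complex.conj_ofReal, Complex.conj_I, map_pow, hc, Complex.exp_add]
    rw [real_inner_comm]
    push_cast
    rw [mul_left_comm, mul_comm (Complex.exp _) (Complex.exp _)]
    congr 3
    ring
  have hbound (ξ : E3) : ‖𝓕 (fun x => f x * g x) ξ‖ₑ ≤ ∫⁻ η : E3, ‖𝓕 (f : E3 → ℂ) η‖ₑ *
        ENNReal.ofReal (s ^ 3 * exp (-(π * ‖ξ - η‖ ^ 2) * s ^ 2)) := by
    rw [hflip, RCLike.enorm_conj]
    refine (enorm_integral_le_lintegral_enorm _).trans_eq ?_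
    congr 1 with η
    rw [enorm_mul, ← norm_fourier_gaussian hs, ofReal_norm, hψdef, RCLike.enorm_conj]
  have hmain : ∫ x, ‖f x‖ ^ 2 * exp (-b * ‖x‖ ^ 2) =
      ‖∫ ξ, ψ ξ * 𝓕 (fun x => f x * g x) ξ‖ := by
    rw [← integral_fourier_mul_eq_flip hψ hfg, hψF]
    have : ∀ x, conj (f x) * (f x * g x) = ((‖f x‖ ^ 2 * exp (-b * ‖x‖ ^ 2) : ℝ) : ℂ) := by
      intro x
      rw [← mul_assoc, RCLike.conj_mul]
      simp [hg]
    simp_rw [this]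
    rw [integral_complex_ofReal, Complex.norm_real, norm_of_nonneg]
    exact integral_nonneg fun x => by positivity
  have hint : Integrable fun x => ‖f x‖ ^ 2 * exp (-b * ‖x‖ ^ 2) := by
    refine ((f.memLp 2).integrable_norm_pow two_ne_zero).mul_bdd (c := 1) (by fun_prop)
      (ae_of_all _ fun x => ?_)
    have : -b * ‖x‖ ^ 2 ≤ 0 := by nlinarith [sq_nonneg ‖x‖]
    simpa using this
  calc ∫⁻ x, ‖f x‖ₑ ^ 2 * ENNReal.ofReal (exp (-b * ‖x‖ ^ 2))
      = ENNReal.ofReal (∫ x, ‖f x‖ ^ 2 * exp (-b * ‖x‖ ^ 2)) := by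
        rw [ofReal_integral_eq_lintegral_ofReal hint (ae_of_all _ fun x => by positivity)]
        congr 1 with x
        rw [ENNReal.ofReal_mul (by positivity), ENNReal.ofReal_pow (norm_nonneg _), ofReal_norm]
    _ ≤ ∫⁻ ξ, ‖ψ ξ * 𝓕 (fun x => f x * g x) ξ‖ₑ := by
        rw [hmain, ofReal_norm]
        exact enorm_integral_le_lintegral_enorm _
    _ ≤ _ := by
        refine lintegral_mono fun ξ => ?_
        simp_rw [mul_assoc]
        rw [lintegral_const_mul' _ _ enorm_ne_top, enorm_mul, hψdef, RCLike.enorm_conj]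
        gcongr
        exact hbound ξ

theorem two_mul_le_schur_weight (u v : ℂ) {ξ η : E3} (hξ : ξ ≠ 0) (hη : η ≠ 0) :
    2 * (‖u‖ₑ * ‖v‖ₑ) ≤ ‖u‖ₑ ^ 2 * ENNReal.ofReal (π * ‖ξ‖ ^ 2) * invSqKernel ‖η‖ +
      ‖v‖ₑ ^ 2 * ENNReal.ofReal (π * ‖η‖ ^ 2) * invSqKernel ‖ξ‖ := by
  have hξ' : 0 < ‖ξ‖ := norm_pos_iff.2 hξ
  have hη' : 0 < ‖η‖ := norm_pos_iff.2 hη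
  have h2 (r : ℝ) : 2 * ENNReal.ofReal r = ENNReal.ofReal (2 * r) := by
    rw [ENNReal.ofReal_mul zero_le_two, ENNReal.ofReal_ofNat]
  rw [invSqKernel_eq hξ', invSqKernel_eq hη', ← ofReal_norm, ← ofReal_norm,
    ← ENNReal.ofReal_pow (norm_nonneg _), ← ENNReal.ofReal_pow (norm_nonneg _),
    ← ENNReal.ofReal_mul (by positivity), ← ENNReal.ofReal_mul (by positivity),
    ← ENNReal.ofReal_mul (by positivity), ← ENNReal.ofReal_mul (by positivity),
    ← ENNReal.ofReal_mul (by positivity), ← ENNReal.ofReal_add (by positivity) (by positivity),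
    h2]
  refine ENNReal.ofReal_le_ofReal ?_
  have h := two_mul_le_add_sq (‖u‖ * (‖ξ‖ / ‖η‖)) (‖v‖ * (‖η‖ / ‖ξ‖))
  have h1 : 2 * (‖u‖ * (‖ξ‖ / ‖η‖)) * (‖v‖ * (‖η‖ / ‖ξ‖)) = 2 * (‖u‖ * ‖v‖) := by field_simp
  rw [h1] at h
  refine h.trans_eq ?_
  field_simp

theorem lintegral_invSqKernel_form_le {F : E3 → ℂ} (hF : Measurable F) :
    ∫⁻ ξ : E3, ∫⁻ η : E3, ‖F ξ‖ₑ * ‖F η‖ₑ * invSqKernel ‖ξ - η‖ ≤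
      ENNReal.ofReal (π ^ 2) * ∫⁻ ξ : E3, ‖ξ‖ₑ * ‖F ξ‖ₑ ^ 2 := by
  have hne : ∀ᵐ ξ : E3, ξ ≠ 0 := compl_mem_ae_iff.2 (measure_singleton 0)
  have hrow : ∫⁻ ξ : E3, ∫⁻ η : E3, ‖F ξ‖ₑ ^ 2 * ENNReal.ofReal (π * ‖ξ‖ ^ 2) *
      invSqKernel ‖η‖ * invSqKernel ‖ξ - η‖ =
      ENNReal.ofReal (π ^ 2) * ∫⁻ ξ : E3, ‖ξ‖ₑ * ‖F ξ‖ₑ ^ 2 := by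
    rw [← lintegral_const_mul _ (by fun_prop)]
    refine lintegral_congr_ae (hne.mono fun ξ hξ => ?_)
    have hξ' : 0 < ‖ξ‖ := norm_pos_iff.2 hξ
    simp_rw [mul_assoc]
    rw [lintegral_const_mul _ (by fun_prop), lintegral_const_mul _ (by fun_prop),
      lintegral_invSqKernel_mul_invSqKernel hξ, ← ENNReal.ofReal_mul (by positivity),
      ← ofReal_norm ξ, ← mul_assoc, ← ENNReal.ofReal_mul (by positivity), mul_comm]
    congr 2
    field_simp
  have hcol : ∫⁻ ξ : E3, ∫⁻ η : E3, ‖F η‖ₑ ^ 2 * ENNReal.ofReal (π * ‖η‖ ^ 2) *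
      invSqKernel ‖ξ‖ * invSqKernel ‖ξ - η‖ =
      ENNReal.ofReal (π ^ 2) * ∫⁻ ξ : E3, ‖ξ‖ₑ * ‖F ξ‖ₑ ^ 2 := by
    rw [lintegral_lintegral_swap (by unfold Function.uncurry; fun_prop), ← hrow]
    simp_rw [norm_sub_rev]
  have h2 : 2 * ∫⁻ ξ : E3, ∫⁻ η : E3, ‖F ξ‖ₑ * ‖F η‖ₑ * invSqKernel ‖ξ - η‖ ≤
      2 * (ENNReal.ofReal (π ^ 2) * ∫⁻ ξ : E3, ‖ξ‖ₑ * ‖F ξ‖ₑ ^ 2) := by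
    calc 2 * ∫⁻ ξ : E3, ∫⁻ η : E3, ‖F ξ‖ₑ * ‖F η‖ₑ * invSqKernel ‖ξ - η‖
        = ∫⁻ ξ : E3, ∫⁻ η : E3, 2 * (‖F ξ‖ₑ * ‖F η‖ₑ) * invSqKernel ‖ξ - η‖ := by
          simp_rw [mul_assoc (2 : ENNReal)]
          rw [← lintegral_const_mul' _ _ (by simp)]
          congr 1 with ξ
          rw [← lintegral_const_mul' _ _ (by simp)]
      _ ≤ ∫⁻ ξ : E3, ∫⁻ η : E3, (‖F ξ‖ₑ ^ 2 * ENNReal.ofReal (π * ‖ξ‖ ^ 2) *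
            invSqKernel ‖η‖ * invSqKernel ‖ξ - η‖ + ‖F η‖ₑ ^ 2 * ENNReal.ofReal (π * ‖η‖ ^ 2) *
            invSqKernel ‖ξ‖ * invSqKernel ‖ξ - η‖) := by
          refine lintegral_mono_ae (hne.mono fun ξ hξ => ?_)
          refine lintegral_mono_ae (hne.mono fun η hη => ?_)
          rw [← add_mul]
          gcongr
          exact two_mul_le_schur_weight _ _ hξ hη
      _ = _ := by
          rw [two_mul]
          nth_rewrite 1 [← hrow]
          rw [← hcol, ← lintegral_add_left]
          · congr 1 with ξ
            rw [lintegral_add_left (by fun_prop)]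
          · exact Measurable.lintegral_prod_right' (f := fun p : E3 × E3 => ‖F p.1‖ₑ ^ 2 *
              ENNReal.ofReal (π * ‖p.1‖ ^ 2) * invSqKernel ‖p.2‖ * invSqKernel ‖p.1 - p.2‖)
              (by fun_prop)
  exact (ENNReal.mul_le_mul_iff_right (by simp) (by simp)).1 h2

/-- **Kato's inequality** with the sharp constant, for Schwartz functions. -/
theorem kato_inequality_schwartz (f : 𝓢(E3, ℂ)) :
    ∫⁻ x : E3, ENNReal.ofReal ‖x‖⁻¹ * ‖f x‖ₑ ^ 2 ≤
      ENNReal.ofReal (π ^ 2) * ∫⁻ ξ : E3, ‖ξ‖ₑ * ‖𝓕 (f : E3 → ℂ) ξ‖ₑ ^ 2 := by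
  have hne : ∀ᵐ x : E3, x ≠ 0 := compl_mem_ae_iff.2 (measure_singleton 0)
  have hfm : Measurable f := f.continuous.measurable
  have hF : Measurable (𝓕 (f : E3 → ℂ)) := by
    rw [← SchwartzMap.fourier_coe]
    exact (𝓕 f).continuous.measurable
  refine le_trans ?_ (lintegral_invSqKernel_form_le hF)
  calc ∫⁻ x : E3, ENNReal.ofReal ‖x‖⁻¹ * ‖f x‖ₑ ^ 2
      = ∫⁻ x : E3, ∫⁻ s in Ioi (0 : ℝ), ENNReal.ofReal (2 * (s ^ 2)⁻¹) *
          (‖f x‖ₑ ^ 2 * ENNReal.ofReal (exp (-(π / s ^ 2) * ‖x‖ ^ 2))) := by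
        refine lintegral_congr_ae (hne.mono fun x hx => ?_)
        have hx' : 0 < ‖x‖ := norm_pos_iff.2 hx
        have h : ENNReal.ofReal ‖x‖⁻¹ = ENNReal.ofReal 2 * ENNReal.ofReal (2 * ‖x‖)⁻¹ := by
          rw [← ENNReal.ofReal_mul (by positivity)]
          congr 1
          field_simp
        simp only
        rw [h, ← lintegral_Ioi_inv_sq_mul_gaussian_inv hx',
          ← lintegral_const_mul _ (by fun_prop), ← lintegral_mul_const _ (by fun_prop)]
        congr 1 with s
        rw [ENNReal.ofReal_mul (by positivity), ENNReal.ofReal_mul (by positivity)]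
        ring
    _ = ∫⁻ s in Ioi (0 : ℝ), ENNReal.ofReal (2 * (s ^ 2)⁻¹) *
          ∫⁻ x : E3, ‖f x‖ₑ ^ 2 * ENNReal.ofReal (exp (-(π / s ^ 2) * ‖x‖ ^ 2)) := by
        rw [lintegral_lintegral_swap (by unfold Function.uncurry; fun_prop)]
        congr 1 with s
        rw [lintegral_const_mul _ (by fun_prop)]
    _ ≤ ∫⁻ s in Ioi (0 : ℝ), ∫⁻ ξ : E3, ∫⁻ η : E3,
          ‖𝓕 (f : E3 → ℂ) ξ‖ₑ * ‖𝓕 (f : E3 → ℂ) η‖ₑ *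
            ENNReal.ofReal (2 * s * exp (-(π * ‖ξ - η‖ ^ 2) * s ^ 2)) := by
        refine setLIntegral_mono' measurableSet_Ioi fun s hs => ?_
        have hs : 0 < s := hs
        refine (mul_le_mul_right (lintegral_norm_sq_mul_gaussian_le f hs) _).trans_eq ?_
        rw [← lintegral_const_mul' _ _ ENNReal.ofReal_ne_top]
        congr 1 with ξ
        rw [← lintegral_const_mul' _ _ ENNReal.ofReal_ne_top]
        congr 1 with η
        rw [mul_left_comm, ← ENNReal.ofReal_mul (by positivity)]
        congr 2
        field_simp
    _ = ∫⁻ ξ : E3, ∫⁻ η : E3, ∫⁻ s in Ioi (0 : ℝ),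
          ‖𝓕 (f : E3 → ℂ) ξ‖ₑ * ‖𝓕 (f : E3 → ℂ) η‖ₑ *
            ENNReal.ofReal (2 * s * exp (-(π * ‖ξ - η‖ ^ 2) * s ^ 2)) := by
        rw [lintegral_lintegral_swap]
        · congr 1 with ξ
          exact lintegral_lintegral_swap (by unfold Function.uncurry; fun_prop)
        · exact (Measurable.lintegral_prod_right' (f := fun q : (ℝ × E3) × E3 =>
            ‖𝓕 (f : E3 → ℂ) q.1.2‖ₑ * ‖𝓕 (f : E3 → ℂ) q.2‖ₑ *
            ENNReal.ofReal (2 * q.1.1 * exp (-(π * ‖q.1.2 - q.2‖ ^ 2) * q.1.1 ^ 2)))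
            (by fun_prop)).aemeasurable
    _ = _ := by
        congr 1 with ξ
        congr 1 with η
        rw [lintegral_const_mul _ (by fun_prop), invSqKernel]

theorem enorm_fourier_comp_add_right (φ : E3 → ℂ) (y ξ : E3) :
    ‖𝓕 (fun x => φ (x + y)) ξ‖ₑ = ‖𝓕 φ ξ‖ₑ := by
  have h := congrFun (VectorFourier.fourierIntegral_comp_add_right 𝐞 volume (innerₗ E3) φ y) ξ
  have h' : 𝓕 (fun x => φ (x + y)) ξ = 𝐞 (innerₗ E3 y ξ) • 𝓕 φ ξ := h
  rw [h', ← ofReal_norm, Circle.norm_smul, ofReal_norm]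

theorem kato_inequality_translate {φ : E3 → ℂ} (hφ : ContDiff ℝ (⊤ : ℕ∞) φ)
    (hsupp : HasCompactSupport φ) (y : E3) :
    ∫⁻ x : E3, ENNReal.ofReal ‖x - y‖⁻¹ * ‖φ x‖ₑ ^ 2 ≤
      ENNReal.ofReal (π ^ 2) * ∫⁻ ξ : E3, ‖ξ‖ₑ * ‖𝓕 φ ξ‖ₑ ^ 2 := by
  have hs : HasCompactSupport fun x => φ (x + y) := hsupp.comp_homeomorph (Homeomorph.addRight y)
  have hc : ContDiff ℝ (⊤ : ℕ∞) fun x => φ (x + y) := hφ.comp (contDiff_id.add contDiff_const)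
  have h := kato_inequality_schwartz (hs.toSchwartzMap hc)
  have hcoe : (hs.toSchwartzMap hc : E3 → ℂ) = fun x => φ (x + y) := rfl
  rw [hcoe] at h
  simp_rw [enorm_fourier_comp_add_right] at h
  rw [← lintegral_add_right_eq_self _ y]
  simpa using h

theorem integrable_norm_mul_norm_fourier_sq (f : 𝓢(E3, ℂ)) :
    Integrable fun ξ => ‖ξ‖ * ‖𝓕 (f : E3 → ℂ) ξ‖ ^ 2 := by
  have h := ((𝓕 f).integrable_pow_mul volume 1).mul_bdd (g := fun ξ => ‖(𝓕 f) ξ‖)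
    (by fun_prop) (ae_of_all _ fun ξ => by
      simpa using (𝓕 f).toBoundedContinuousFunction.norm_coe_le_norm ξ)
  simpa [SchwartzMap.fourier_coe, mul_assoc, sq] using h

end KatoInequality

theorem kato_inequality_coulomb_measure
    (μ : Measure (EuclideanSpace ℝ (Fin 3))) [IsFiniteMeasure μ]
    (φ : EuclideanSpace ℝ (Fin 3) → ℂ)
    (hφ : ContDiff ℝ (⊤ : ℕ∞) φ) (hsupp : HasCompactSupport φ) :
    ∫⁻ x, coulombE μ x * ENNReal.ofReal (‖φ x‖ ^ 2) ≤
      ENNReal.ofReal (π ^ 2 * (μ Set.univ).toReal *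
        ∫ ξ, ‖ξ‖ * ‖𝓕 φ ξ‖ ^ 2) := by
  have hφm : Measurable φ := hφ.continuous.measurable
  have hR : ENNReal.ofReal (∫ ξ, ‖ξ‖ * ‖𝓕 φ ξ‖ ^ 2) = ∫⁻ ξ, ‖ξ‖ₑ * ‖𝓕 φ ξ‖ₑ ^ 2 := by
    have hint : Integrable fun ξ => ‖ξ‖ * ‖𝓕 φ ξ‖ ^ 2 :=
      integrable_norm_mul_norm_fourier_sq (hsupp.toSchwartzMap hφ)
    rw [ofReal_integral_eq_lintegral_ofReal hint
      (ae_of_all _ fun _ => by positivity)]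
    congr 1 with ξ
    rw [ENNReal.ofReal_mul (norm_nonneg _), ENNReal.ofReal_pow (norm_nonneg _), ofReal_norm,
      ofReal_norm]
  calc ∫⁻ x, coulombE μ x * ENNReal.ofReal (‖φ x‖ ^ 2)
      = ∫⁻ x, ∫⁻ y, ENNReal.ofReal ‖x - y‖⁻¹ * ‖φ x‖ₑ ^ 2 ∂μ := by
        congr 1 with x
        rw [ENNReal.ofReal_pow (norm_nonneg _), ofReal_norm, coulombE,
          lintegral_mul_const _ (by fun_prop)]
    _ = ∫⁻ y, (∫⁻ x, ENNReal.ofReal ‖x - y‖⁻¹ * ‖φ x‖ₑ ^ 2) ∂μ :=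
        lintegral_lintegral_swap (by unfold Function.uncurry; fun_prop)
    _ ≤ ∫⁻ _, ENNReal.ofReal (π ^ 2) * (∫⁻ ξ, ‖ξ‖ₑ * ‖𝓕 φ ξ‖ₑ ^ 2) ∂μ :=
        lintegral_mono fun y => kato_inequality_translate hφ hsupp y
    _ = _ := by
        rw [lintegral_const, ENNReal.ofReal_mul (by positivity), hR,
          ENNReal.ofReal_mul (by positivity), ENNReal.ofReal_toReal (measure_ne_top _ _)]
        ring
end
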